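/- Fix an arbitrary triple of distinct primes p, q, r. Then the union over all exponents a, b, c (with p^a, q^b, r^c > 2) of the coefficient sets A_{p^a,q^b,r^c} of the unitary cyclotomic polynomials Φ*_{p^a q^b r^c} equals all of ℤ. -/

import Mathlib

open Polynomial

/-- The ternary inclusion-exclusion polynomial `Q_{p,q,r}`. -/
noncomputable def Qpoly (p q r : ℕ) : Polynomial ℤ :=
  ((X ^ (p * q * r) - 1) * (X ^ p - 1) * (X ^ q - 1) * (X ^ r - 1)) /ₘ
    ((X ^ (p * q) - 1) * (X ^ (q * r) - 1) * (X ^ (r * p) - 1) * (X - 1))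

/-- The set `A_{p,q,r}` of coefficients of `Q_{p,q,r}` (whose degree is `(p-1)(q-1)(r-1)`). -/
noncomputable def coeffSet (p q r : ℕ) : Set ℤ :=
  {n : ℤ | ∃ m : ℕ, m ≤ (p - 1) * (q - 1) * (r - 1) ∧ (Qpoly p q r).coeff m = n}

noncomputable def binaryPoly (P k : ℕ) : ℤ[X] :=
  ∑ u ∈ Finset.range (1 + k * P - k), X ^ (u * P) -
    ∑ u ∈ Finset.range k, ∑ v ∈ Finset.range (P - 1), X ^ (1 + u * P + v * (1 + k * P))

theorem binaryPoly_mul {P k : ℕ} (hP : 0 < P) :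
    binaryPoly P k * ((X ^ P - 1) * (X ^ (1 + k * P) - 1)) =
      (X ^ (P * (1 + k * P)) - 1) * (X - 1) := by
  obtain ⟨p, rfl⟩ : ∃ p, P = p + 1 := ⟨P - 1, by omega⟩
  have h1 : 1 + k * (p + 1) - k = 1 + k * p := by rw [mul_add, mul_one]; omega
  have e1 := geom_sum_mul ((X : ℤ[X]) ^ (p + 1)) (1 + k * p)
  have e2 := geom_sum_mul ((X : ℤ[X]) ^ (p + 1)) k
  have e3 := geom_sum_mul ((X : ℤ[X]) ^ (1 + k * (p + 1))) p
  have hA : binaryPoly (p + 1) k =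
      ∑ u ∈ Finset.range (1 + k * p), ((X : ℤ[X]) ^ (p + 1)) ^ u -
        X * ((∑ u ∈ Finset.range k, (X ^ (p + 1)) ^ u) *
          ∑ v ∈ Finset.range p, (X ^ (1 + k * (p + 1))) ^ v) := by
    rw [binaryPoly, h1, Finset.sum_mul_sum, Finset.mul_sum]
    congr 1
    · exact Finset.sum_congr rfl fun u _ => by ring
    · refine Finset.sum_congr rfl fun u _ => ?_
      rw [Finset.mul_sum]
      exact Finset.sum_congr rfl fun v _ => by simp only [← pow_mul]; ring
  rw [hA]
  linear_combination (X ^ (1 + k * (p + 1)) - 1) * e1 -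
    X * (X ^ (1 + k * (p + 1)) - 1) * (∑ v ∈ Finset.range p, (X ^ (1 + k * (p + 1))) ^ v) * e2 -
    X * ((X ^ (p + 1)) ^ k - 1) * e3

theorem binaryPoly_monic {P k : ℕ} (hP : 0 < P) : (binaryPoly P k).Monic := by
  have hm : ((X ^ P - 1 : ℤ[X]) * (X ^ (1 + k * P) - 1)).Monic :=
    (monic_X_pow_sub_C 1 hP.ne').mul (monic_X_pow_sub_C 1 (by omega))
  refine hm.of_mul_monic_right ?_
  rw [binaryPoly_mul hP]
  exact (monic_X_pow_sub_C 1 (by positivity)).mul (monic_X_sub_C 1)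

theorem binaryPoly_coeff (P k j : ℕ) :
    (binaryPoly P k).coeff j =
      ∑ u ∈ Finset.range (1 + k * P - k), (if j = u * P then 1 else 0) -
        ∑ u ∈ Finset.range k, ∑ v ∈ Finset.range (P - 1),
          (if j = 1 + u * P + v * (1 + k * P) then 1 else 0) := by
  simp only [binaryPoly, coeff_sub, finsetSum_coeff, coeff_X_pow]

theorem abs_binaryPoly_coeff_le {P k : ℕ} (hP : 0 < P) (j : ℕ) :
    |(binaryPoly P k).coeff j| ≤ 1 := by
  rw [binaryPoly_coeff, ← Finset.sum_product', Finset.sum_boole, Finset.sum_boole]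
  have h1 : (Finset.filter (fun u => j = u * P) (Finset.range (1 + k * P - k))).card ≤ 1 := by
    refine Finset.card_le_one.2 fun a ha b hb => ?_
    simp only [Finset.mem_filter] at ha hb
    exact Nat.eq_of_mul_eq_mul_right hP (ha.2.symm.trans hb.2)
  have h2 : (Finset.filter (fun x : ℕ × ℕ => j = 1 + x.1 * P + x.2 * (1 + k * P))
      (Finset.range k ×ˢ Finset.range (P - 1))).card ≤ 1 := by
    refine Finset.card_le_one.2 fun a ha b hb => ?_
    simp only [Finset.mem_filter, Finset.mem_product, Finset.mem_range] at ha hb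
    have key : ∀ x : ℕ × ℕ, x.1 < k → j = 1 + x.1 * P + x.2 * (1 + k * P) →
        x.2 = j / (1 + k * P) ∧ 1 + x.1 * P = j % (1 + k * P) := by
      intro x hx hj
      have hlt : 1 + x.1 * P < 1 + k * P := by
        have := Nat.mul_lt_mul_of_pos_right hx hP
        omega
      subst hj
      rw [Nat.add_mul_div_right _ _ (by omega), Nat.add_mul_mod_self_right,
        Nat.div_eq_of_lt hlt, Nat.mod_eq_of_lt hlt]
      simp
    have ka := key a ha.1.1 ha.2
    have kb := key b hb.1.1 hb.2
    refine Prod.ext (Nat.eq_of_mul_eq_mul_right hP ?_) (ka.1.trans kb.1.symm)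
    omega
  rw [abs_le]
  omega

/-- Modulo `A` and `x ^ (P * R) - 1`, the order of `x` divides `gcd (P * Q) (P * R) = P`. -/
theorem isCoprime_X_pow_mul_sub_one {K : Type*} [Field K] {A : K[X]} {P Q R : ℕ}
    (hQR : Q.Coprime R) (hA : A ∣ X ^ (P * Q) - 1) (h : IsCoprime A (X ^ P - 1)) :
    IsCoprime A (X ^ (P * R) - 1) := by
  rw [← Ideal.isCoprime_span_singleton_iff, Ideal.isCoprime_iff_sup_eq] at h ⊢
  set I := Ideal.span {A} ⊔ Ideal.span {X ^ (P * R) - 1} with hI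
  have hAI : Ideal.span {A} ≤ I := le_sup_left
  refine top_le_iff.1 (h ▸ sup_le hAI ?_)
  rw [Ideal.span_singleton_le_iff_mem]
  have one_of_mem : ∀ n, (X ^ n - 1 : K[X]) ∈ I ↔ (Ideal.Quotient.mk I X) ^ n = 1 := by
    intro n
    rw [← Ideal.Quotient.eq_zero_iff_mem]
    simp [sub_eq_zero]
  have h1 := (one_of_mem (P * Q)).1 (hAI (Ideal.mem_span_singleton.2 hA))
  have h2 := (one_of_mem (P * R)).1
    ((le_sup_right : _ ≤ I) (Ideal.mem_span_singleton_self _))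
  rw [one_of_mem, ← orderOf_dvd_iff_pow_eq_one]
  have := Nat.dvd_gcd (orderOf_dvd_of_pow_eq_one h1) (orderOf_dvd_of_pow_eq_one h2)
  rwa [Nat.gcd_mul_left, hQR.gcd_eq_one, mul_one] at this

theorem isCoprime_of_mul_eq {A : ℚ[X]} {P Q : ℕ} (hP : 0 < P) (hQ : 0 < Q)
    (h : A * ((X ^ P - 1) * (X ^ Q - 1)) = (X ^ (P * Q) - 1) * (X - 1)) :
    IsCoprime A (X ^ P - 1) := by
  have hX : (X - 1 : ℚ[X]) ≠ 0 := X_sub_C_ne_zero 1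
  have h' : A * (X ^ P - 1) * ∑ i ∈ Finset.range Q, X ^ i = X ^ (P * Q) - 1 := by
    refine mul_right_cancel₀ hX ?_
    rw [← h, mul_assoc, geom_sum_mul, mul_assoc]
  have hs : (X ^ (P * Q) - 1 : ℚ[X]).Separable :=
    separable_X_pow_sub_C 1 (by exact_mod_cast (by positivity : P * Q ≠ 0)) one_ne_zero
  rw [← h'] at hs
  exact hs.of_mul_left.isCoprime

theorem dvd_expand_of_mul_eq {A : ℤ[X]} (hA : A.Monic) {P Q R : ℕ} (hP : 0 < P) (hQ : 0 < Q)
    (hPR : P.Coprime R) (hQR : Q.Coprime R)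
    (h : A * ((X ^ P - 1) * (X ^ Q - 1)) = (X ^ (P * Q) - 1) * (X - 1)) :
    A ∣ expand ℤ R A := by
  rw [← map_dvd_map (Int.castRingHom ℚ) (RingHom.injective_int _) hA, map_expand]
  have h := congrArg (Polynomial.map (Int.castRingHom ℚ)) h
  simp only [Polynomial.map_mul, Polynomial.map_sub, Polynomial.map_pow, Polynomial.map_X,
    Polynomial.map_one] at h
  set B := A.map (Int.castRingHom ℚ)
  have hB : B ∣ X ^ (P * Q) - 1 := by
    refine (mul_dvd_mul_iff_right (X_sub_C_ne_zero (1 : ℚ))).1 ?_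
    rw [C_1, ← h, ← geom_sum_mul X Q]
    exact ⟨(X ^ P - 1) * ∑ i ∈ Finset.range Q, X ^ i, by ring⟩
  have hc1 := isCoprime_X_pow_mul_sub_one hQR hB (isCoprime_of_mul_eq hP hQ h)
  have hc2 := isCoprime_X_pow_mul_sub_one hPR (mul_comm P Q ▸ hB)
    (isCoprime_of_mul_eq (A := B) hQ hP (by rw [mul_comm Q P, ← h]; ring))
  have he := congrArg (expand ℚ R) h
  simp only [map_mul, map_sub, map_pow, expand_X, map_one, ← pow_mul] at he
  refine (hc1.mul_right hc2).dvd_of_dvd_mul_right ?_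
  rw [mul_comm P R, mul_comm Q R, he]
  refine (hB.trans ?_).mul_right _
  have := sub_dvd_pow_sub_pow (X ^ (P * Q) : ℚ[X]) 1 R
  rwa [one_pow, ← pow_mul, mul_comm _ R] at this

theorem divisor_monic {P Q R : ℕ} (hP : 0 < P) (hQ : 0 < Q) (hR : 0 < R) :
    ((X ^ (P * Q) - 1) * (X ^ (Q * R) - 1) * (X ^ (R * P) - 1) * (X - 1) : ℤ[X]).Monic :=
  (((monic_X_pow_sub_C 1 (by positivity)).mul (monic_X_pow_sub_C 1 (by positivity))).mul
    (monic_X_pow_sub_C 1 (by positivity))).mul (monic_X_sub_C 1)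

theorem Qpoly_mul {A : ℤ[X]} (hA : A.Monic) {P Q R : ℕ} (hP : 0 < P) (hQ : 0 < Q)
    (hR : 0 < R) (hPR : P.Coprime R) (hQR : Q.Coprime R)
    (h : A * ((X ^ P - 1) * (X ^ Q - 1)) = (X ^ (P * Q) - 1) * (X - 1)) :
    Qpoly P Q R * A = expand ℤ R A := by
  obtain ⟨Y, hY⟩ := dvd_expand_of_mul_eq hA hP hQ hPR hQR h
  have hD := divisor_monic hP hQ hR
  have he := congrArg (expand ℤ R) h
  simp only [map_mul, map_sub, map_pow, expand_X, map_one, ← pow_mul] at he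
  rw [hY] at he
  have key : (X ^ (P * Q * R) - 1) * (X ^ P - 1) * (X ^ Q - 1) * (X ^ R - 1) =
      ((X ^ (P * Q) - 1) * (X ^ (Q * R) - 1) * (X ^ (R * P) - 1) * (X - 1)) * Y := by
    have e1 : P * Q * R = R * (P * Q) := by ring
    rw [e1, mul_comm Q R]
    linear_combination (-(X ^ P - 1) * (X ^ Q - 1)) * he +
      Y * (X ^ (R * P) - 1) * (X ^ (R * Q) - 1) * h
  rw [Qpoly, key, mul_divByMonic_cancel_left _ hD, hY, mul_comm]

theorem natDegree_Qpoly {A : ℤ[X]} (hA : A.Monic) {P Q R : ℕ} (hP : 0 < P) (hQ : 0 < Q)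
    (hR : 0 < R) (hPR : P.Coprime R) (hQR : Q.Coprime R)
    (h : A * ((X ^ P - 1) * (X ^ Q - 1)) = (X ^ (P * Q) - 1) * (X - 1)) :
    (Qpoly P Q R).natDegree = (P - 1) * (Q - 1) * (R - 1) := by
  have hmul := Qpoly_mul hA hP hQ hR hPR hQR h
  have hA0 := hA.ne_zero
  have hY0 : Qpoly P Q R ≠ 0 := by
    rintro h0
    rw [h0, zero_mul, eq_comm, expand_eq_zero hR] at hmul
    exact hA0 hmul
  have h1 := congrArg natDegree hmul
  rw [natDegree_mul hY0 hA0, natDegree_expand] at h1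
  have m : ∀ {n : ℕ}, 0 < n → (X ^ n - 1 : ℤ[X]).Monic := fun hn =>
    monic_X_pow_sub_C 1 hn.ne'
  have m1 : (X - 1 : ℤ[X]).Monic := monic_X_sub_C 1
  have d : ∀ n : ℕ, (X ^ n - 1 : ℤ[X]).natDegree = n := fun n => natDegree_X_pow_sub_C
  have h2 := congrArg natDegree h
  rw [hA.natDegree_mul ((m hP).mul (m hQ)), (m hP).natDegree_mul (m hQ),
    (m (Nat.mul_pos hP hQ)).natDegree_mul m1, d, d, d,
    show (X - 1 : ℤ[X]).natDegree = 1 from natDegree_X_sub_C 1] at h2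
  obtain ⟨P, rfl⟩ : ∃ p, P = p + 1 := ⟨P - 1, by omega⟩
  obtain ⟨Q, rfl⟩ : ∃ p, Q = p + 1 := ⟨Q - 1, by omega⟩
  obtain ⟨R, rfl⟩ : ∃ p, R = p + 1 := ⟨R - 1, by omega⟩
  simp only [Nat.add_sub_cancel]
  have : A.natDegree = P * Q := by nlinarith
  rw [this] at h1
  nlinarith

/-- The indicator function of `{m | m mod M < P}`. -/
def residueIndicator (M P m : ℤ) : ℤ := if m % M < P then 1 else 0

/-- The `n`-th coefficient of `(1 - x ^ P) (1 - x ^ Q) / ((1 - x) (1 - x ^ (P * Q)))`. -/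
def inverseCoeff (P Q n : ℤ) : ℤ :=
  residueIndicator (P * Q) P n - residueIndicator (P * Q) P (n - Q)

theorem mk_residueIndicator_mul {M P : ℕ} (hPM : P ≤ M) :
    PowerSeries.mk (fun n : ℕ => residueIndicator M P n) * (1 - PowerSeries.X ^ M) =
      ∑ i ∈ Finset.range P, PowerSeries.X ^ i := by
  ext n
  rw [mul_sub, mul_one, map_sub, PowerSeries.coeff_mk, PowerSeries.coeff_mul_X_pow', map_sum]
  simp only [PowerSeries.coeff_X_pow, PowerSeries.coeff_mk, residueIndicator]
  rw [Finset.sum_ite_eq]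
  simp only [Finset.mem_range]
  by_cases hn : M ≤ n
  · rw [if_pos hn, if_neg (by omega : ¬ n < P), Nat.cast_sub hn, Int.sub_emod_right, sub_self]
  · rw [if_neg hn, Int.emod_eq_of_lt (by omega) (by omega)]
    simp

theorem mk_inverseCoeff_mul {P Q : ℕ} (hP : 2 ≤ P) (hQ : 2 ≤ Q) :
    PowerSeries.mk (fun n : ℕ => inverseCoeff P Q n) *
        ((1 - PowerSeries.X) * (1 - PowerSeries.X ^ (P * Q))) =
      (1 - PowerSeries.X ^ P) * (1 - PowerSeries.X ^ Q) := by
  have hPQ : P + Q ≤ P * Q := by nlinarith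
  have h1 : PowerSeries.mk (fun n : ℕ => inverseCoeff P Q n) =
      PowerSeries.mk (fun n : ℕ => residueIndicator (P * Q : ℕ) P n) *
        (1 - PowerSeries.X ^ Q) := by
    ext n
    rw [mul_sub, mul_one, map_sub, PowerSeries.coeff_mul_X_pow']
    simp only [PowerSeries.coeff_mk, inverseCoeff]
    push_cast
    congr 1
    split_ifs with h
    · rw [Nat.cast_sub h]
    · rw [residueIndicator, if_neg]
      rw [← Int.add_emod_right, Int.emod_eq_of_lt] <;> zify at * <;> omega
  have h2 := mk_residueIndicator_mul (M := P * Q) (P := P) (by omega)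
  have h3 := mul_neg_geom_sum (PowerSeries.X : PowerSeries ℤ) P
  rw [h1]
  linear_combination (1 - PowerSeries.X ^ Q) * (1 - PowerSeries.X) * h2 +
    (1 - PowerSeries.X ^ Q) * h3

theorem Qpoly_coeff {A : ℤ[X]} (hA : A.Monic) {P Q R : ℕ} (hP : 2 ≤ P) (hQ : 2 ≤ Q)
    (hR : 0 < R) (hPR : P.Coprime R) (hQR : Q.Coprime R)
    (h : A * ((X ^ P - 1) * (X ^ Q - 1)) = (X ^ (P * Q) - 1) * (X - 1)) {N t : ℕ}
    (ht : t < R) :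
    (Qpoly P Q R).coeff (R * N + t) =
      ∑ j ∈ Finset.range (N + 1), A.coeff j * inverseCoeff P Q (R * (N - j) + t) := by
  have hmul := Qpoly_mul hA (by omega) (by omega) hR hPR hQR h
  set c := PowerSeries.mk (fun n : ℕ => inverseCoeff P Q n) with hc
  have hcm := mk_inverseCoeff_mul hP hQ
  rw [← hc] at hcm
  have hA' := congrArg (Polynomial.coeToPowerSeries.ringHom (R := ℤ)) h
  have hmul' := congrArg (Polynomial.coeToPowerSeries.ringHom (R := ℤ)) hmul
  simp only [map_mul, map_sub, map_pow, map_one, coeToPowerSeries.ringHom_apply, coe_X] at hA' hmul'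
  have hAc : (A : PowerSeries ℤ) * c = 1 := by
    have h0 : ∀ {n : ℕ}, 0 < n → (1 - PowerSeries.X ^ n : PowerSeries ℤ) ≠ 0 := by
      intro n hn h0
      have := congrArg (PowerSeries.coeff 0) h0
      simp [hn.ne'] at this
    refine mul_right_cancel₀ (mul_ne_zero (h0 (n := P) (by omega)) (h0 (n := Q) (by omega))) ?_
    refine mul_right_cancel₀ (mul_ne_zero (h0 (n := 1) (by omega))
      (h0 (n := P * Q) (by positivity))) ?_
    rw [pow_one]
    linear_combination (A : PowerSeries ℤ) * (1 - PowerSeries.X ^ P) * (1 - PowerSeries.X ^ Q) * hcm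
      + (1 - PowerSeries.X ^ P) * (1 - PowerSeries.X ^ Q) * hA'
  have hY : (Qpoly P Q R : PowerSeries ℤ) = (expand ℤ R A : ℤ[X]) * c := by
    rw [← hmul', mul_assoc, hAc, mul_one]
  rw [← coeff_coe, hY, PowerSeries.coeff_mul]
  simp only [coeff_coe, coeff_expand hR, hc, PowerSeries.coeff_mk, ite_mul, zero_mul]
  rw [← Finset.sum_filter]
  symm
  refine Finset.sum_bij (fun j _ => (R * j, R * (N - j) + t)) ?_ ?_ ?_ ?_
  · intro j hj
    have : j ≤ N := by simpa [Nat.lt_succ_iff] using hj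
    simp only [Finset.mem_filter, Finset.HasAntidiagonal.mem_antidiagonal, dvd_mul_right, and_true]
    rw [← add_assoc, ← mul_add, Nat.add_sub_cancel' this]
  · intro a _ b _ hab
    exact Nat.eq_of_mul_eq_mul_left hR (Prod.ext_iff.1 hab).1
  · rintro ⟨x, y⟩ hxy
    simp only [Finset.mem_filter, Finset.HasAntidiagonal.mem_antidiagonal] at hxy
    obtain ⟨hxy, j, rfl⟩ := hxy
    have hj : j < N + 1 := by
      by_contra hj
      have : R * (N + 1) ≤ R * j := Nat.mul_le_mul_left _ (by omega)
      rw [mul_add] at this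
      omega
    refine ⟨j, Finset.mem_range.2 hj, Prod.ext rfl ?_⟩
    have : R * N = R * j + R * (N - j) := by
      rw [← mul_add, Nat.add_sub_cancel' (by omega)]
    simp only
    omega
  · intro j hj
    have : j ≤ N := by simpa [Nat.lt_succ_iff] using hj
    rw [Nat.mul_div_cancel_left _ hR]
    push_cast [this]
    rfl

theorem residueIndicator_congr {M P m n : ℤ} (h : m ≡ n [ZMOD M]) :
    residueIndicator M P m = residueIndicator M P n := by
  rw [residueIndicator, residueIndicator, h]

theorem inverseCoeff_congr {P Q m n : ℤ} (h : m ≡ n [ZMOD P * Q]) :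
    inverseCoeff P Q m = inverseCoeff P Q n := by
  rw [inverseCoeff, inverseCoeff, residueIndicator_congr h,
    residueIndicator_congr (h.sub_right Q)]

theorem abs_inverseCoeff_le (P Q n : ℤ) : |inverseCoeff P Q n| ≤ 1 := by
  unfold inverseCoeff residueIndicator
  split_ifs <;> simp

theorem sum_binaryPoly_coeff_mul {P k V : ℕ} (hP : 0 < P) (hV : V ≤ P - 1) (f : ℕ → ℤ) :
    ∑ j ∈ Finset.range (V * (1 + k * P)), (binaryPoly P k).coeff j * f j =
      ∑ u ∈ Finset.range (1 + k * P - k) with u * P < V * (1 + k * P), f (u * P) -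
        ∑ x ∈ Finset.range k ×ˢ Finset.range V, f (1 + x.1 * P + x.2 * (1 + k * P)) := by
  simp only [binaryPoly_coeff, sub_mul, Finset.sum_sub_distrib, Finset.sum_mul, ite_mul, one_mul,
    zero_mul]
  congr 1
  · rw [Finset.sum_comm, Finset.sum_filter]
    refine Finset.sum_congr rfl fun u _ => ?_
    rw [Finset.sum_ite_eq']
    simp only [Finset.mem_range]
  · rw [Finset.sum_comm, Finset.sum_product]
    refine Finset.sum_congr rfl fun u hu => ?_
    rw [Finset.sum_comm]
    simp only [Finset.sum_ite_eq', Finset.mem_range]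
    rw [← Finset.sum_filter]
    refine Finset.sum_congr ?_ fun _ _ => rfl
    ext v
    have hu' := Nat.mul_lt_mul_of_pos_right (Finset.mem_range.1 hu) hP
    simp only [Finset.mem_filter, Finset.mem_range]
    constructor
    · rintro ⟨-, h⟩
      by_contra hv
      have := Nat.mul_le_mul_right (1 + k * P) (not_lt.1 hv)
      omega
    · intro h
      have := Nat.mul_le_mul_right (1 + k * P) (Nat.succ_le_of_lt h)
      rw [Nat.succ_mul] at this
      omega

/-- Every window of length `P` modulo `P * Q` contains exactly one multiple of `P`. -/
theorem sum_residueIndicator_mul_le_one {P Q : ℕ} (hP : 0 < P) {ρ : ℤ} (hρ : IsCoprime (Q : ℤ) ρ)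
    (s : ℤ) {U : Finset ℕ} (hU : ∀ u ∈ U, u < Q) :
    ∑ u ∈ U, residueIndicator (P * Q) P (s - ρ * (u * P : ℕ)) ≤ 1 := by
  simp only [residueIndicator]
  rw [Finset.sum_boole]
  norm_cast
  refine Finset.card_le_one.2 fun a ha b hb => ?_
  simp only [Finset.mem_filter] at ha hb
  have hQ : 0 < Q := (Nat.zero_le _).trans_lt (hU a ha.1)
  have hM : ((P * Q : ℕ) : ℤ) ≠ 0 := by positivity
  have a0 := Int.emod_nonneg (s - ρ * (a * P : ℕ)) hM
  have b0 := Int.emod_nonneg (s - ρ * (b * P : ℕ)) hM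
  have a1 := Int.emod_add_mul_ediv (s - ρ * (a * P : ℕ)) (P * Q : ℕ)
  have b1 := Int.emod_add_mul_ediv (s - ρ * (b * P : ℕ)) (P * Q : ℕ)
  have a2 := ha.2
  have b2 := hb.2
  generalize (s - ρ * (a * P : ℕ)) % (P * Q : ℕ) = e at *
  generalize (s - ρ * (b * P : ℕ)) % (P * Q : ℕ) = e' at *
  generalize (s - ρ * (a * P : ℕ)) / (P * Q : ℕ) = z at *
  generalize (s - ρ * (b * P : ℕ)) / (P * Q : ℕ) = z' at *
  push_cast at a1 b1
  have he : (P : ℤ) ∣ e - e' := ⟨ρ * (b - a) + Q * (z' - z), by linear_combination a1 - b1⟩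
  have he0 : e - e' = 0 := Int.eq_zero_of_abs_lt_dvd he (by rw [abs_lt]; omega)
  have hPz : (P : ℤ) ≠ 0 := by positivity
  have hd : (Q : ℤ) ∣ ρ * (b - a) := by
    refine ⟨z - z', mul_left_cancel₀ hPz ?_⟩
    linear_combination he0 - a1 + b1
  have hab := Int.eq_zero_of_abs_lt_dvd (hρ.dvd_of_dvd_mul_left hd) (by
    have := hU a ha.1
    have := hU b hb.1
    rw [abs_lt]; omega)
  omega

theorem sum_residueIndicator_nonneg {ι : Type*} (U : Finset ι) (M P : ℤ) (f : ι → ℤ) :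
    0 ≤ ∑ u ∈ U, residueIndicator M P (f u) :=
  Finset.sum_nonneg fun _ _ => by unfold residueIndicator; split_ifs <;> simp

/-- The number of negative terms of `binaryPoly P k` below degree `V * (1 + k * P)` whose exponent
`j` satisfies `0 ≤ s - ρ * j < P` modulo `P * (1 + k * P)`. -/
def negCount (P k V : ℕ) (ρ s : ℤ) : ℤ :=
  ∑ x ∈ Finset.range k ×ˢ Finset.range V, residueIndicator (P * (1 + k * P : ℕ)) P
    (s - ρ * (1 + x.1 * P + x.2 * (1 + k * P) : ℕ))

theorem abs_sum_add_negCount_le {P k V : ℕ} (hP : 0 < P) (hk : 0 < k) (hV : V ≤ P - 1) {ρ : ℤ}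
    (hρ : IsCoprime ((1 + k * P : ℕ) : ℤ) ρ) (s : ℤ) :
    |∑ j ∈ Finset.range (V * (1 + k * P)),
        (binaryPoly P k).coeff j * inverseCoeff P (1 + k * P : ℕ) (s - ρ * j) +
      (negCount P k V ρ s - negCount P k V ρ (s - (1 + k * P : ℕ)))| ≤ 1 := by
  rw [sum_binaryPoly_coeff_mul hP hV fun j => inverseCoeff P (1 + k * P : ℕ) (s - ρ * j)]
  simp only [inverseCoeff, Finset.sum_sub_distrib, negCount, sub_right_comm s _ ((1 + k * P : ℕ) : ℤ)]
  have hU : ∀ u ∈ (Finset.range (1 + k * P - k)).filter (fun u => u * P < V * (1 + k * P)),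
      u < 1 + k * P := by
    intro u hu
    have := (Finset.mem_range.1 (Finset.mem_filter.1 hu).1)
    omega
  have h1 := sum_residueIndicator_mul_le_one hP hρ s hU
  have h2 := sum_residueIndicator_mul_le_one hP hρ (s - (1 + k * P : ℕ)) hU
  have h3 := sum_residueIndicator_nonneg
    ((Finset.range (1 + k * P - k)).filter (fun u => u * P < V * (1 + k * P)))
    (P * (1 + k * P : ℕ)) P fun u => s - ρ * (u * P : ℕ)
  have h4 := sum_residueIndicator_nonneg
    ((Finset.range (1 + k * P - k)).filter (fun u => u * P < V * (1 + k * P)))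
    (P * (1 + k * P : ℕ)) P fun u => s - (1 + k * P : ℕ) - ρ * (u * P : ℕ)
  rw [abs_le]
  constructor <;> linarith

theorem negCount_eq_zero {P k V G E r β : ℕ} (hr : 1 < r) (hG : 0 < G) (hP : P = 1 + G * β)
    (hEG : E ∣ G) (hrEG : r * G ∣ E * G) (hk : ∀ g : ℤ, (r * G : ℤ) ∣ k * g → (E : ℤ) ∣ g)
    (hrk : r ∣ k) (hle : r * G ≤ P) (hV : r * G * V ≤ G * P) :
    negCount P k V (r * G : ℕ) ((r * G : ℕ) - G) = 0 := by
  have hP0 : 0 < P := by omega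
  refine Finset.sum_eq_zero fun x hx => ?_
  obtain ⟨u, v⟩ := x
  simp only [Finset.mem_product, Finset.mem_range] at hx
  rw [residueIndicator, if_neg]
  intro hlt
  have hM : (P * (1 + k * P : ℕ) : ℤ) ≠ 0 := by positivity
  have h0 := Int.emod_nonneg
    (((r * G : ℕ) - G : ℤ) - (r * G : ℕ) * (1 + u * P + v * (1 + k * P) : ℕ)) hM
  have h1 := Int.emod_add_mul_ediv
    (((r * G : ℕ) - G : ℤ) - (r * G : ℕ) * (1 + u * P + v * (1 + k * P) : ℕ))
    (P * (1 + k * P : ℕ))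
  dsimp only at hlt
  generalize (((r * G : ℕ) - G : ℤ) - (r * G : ℕ) * (1 + u * P + v * (1 + k * P) : ℕ)) %
    (P * (1 + k * P : ℕ)) = e at *
  generalize (((r * G : ℕ) - G : ℤ) - (r * G : ℕ) * (1 + u * P + v * (1 + k * P) : ℕ)) /
    (P * (1 + k * P : ℕ)) = z at *
  obtain ⟨i, rfl⟩ : ∃ i, z = -i := ⟨-z, by ring⟩
  push_cast at h1
  have hGz : (0 : ℤ) < G := by positivity
  have hPz : (0 : ℤ) < P := by positivity
  have hrz : (1 : ℤ) < r := by exact_mod_cast hr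
  have hlez : (r * G : ℤ) ≤ P := by exact_mod_cast hle
  have hVz : (r * G * V : ℤ) ≤ G * P := by exact_mod_cast hV
  have hPe : (P : ℤ) = 1 + G * β := by exact_mod_cast hP
  have huk : (u : ℤ) + 1 ≤ k := by exact_mod_cast hx.1
  have hvV : (v : ℤ) + 1 ≤ V := by exact_mod_cast hx.2
  have hρ : (0 : ℤ) < r * G := by positivity
  have hrEGz : (r * G : ℤ) ∣ E * G := by exact_mod_cast hrEG
  set ρ : ℤ := r * G with hρd
  obtain ⟨g, hg⟩ : ∃ g, g = i * P - ρ * v := ⟨_, rfl⟩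
  have hgQ : g * (1 + k * P) = ρ * u * P + e + G := by
    rw [hg]; linear_combination -h1
  have hGρ : (G : ℤ) ≤ ρ := by nlinarith
  have hQpos : (0 : ℤ) < 1 + k * P := by positivity
  have hg0 : 0 < g := by
    have : 0 < g * (1 + k * P) := by rw [hgQ]; positivity
    exact pos_of_mul_pos_left this hQpos.le
  have hgρ : g < ρ := by
    refine lt_of_mul_lt_mul_right ?_ hQpos.le
    rw [hgQ]
    have : ρ * P * (u + 1) ≤ ρ * P * k := mul_le_mul_of_nonneg_left huk (by positivity)
    nlinarith
  have hdiv : (P : ℤ) ∣ G + e - g := ⟨k * g - ρ * u, by linear_combination -hgQ⟩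
  obtain ⟨c, hc⟩ := hdiv
  have hc0 : -1 < c := by
    refine lt_of_mul_lt_mul_left (a := (P : ℤ)) ?_ hPz.le
    linarith
  have hc1 : c < 2 := by
    refine lt_of_mul_lt_mul_left (a := (P : ℤ)) ?_ hPz.le
    linarith
  have hkg : k * g = ρ * u + c := by
    refine mul_left_cancel₀ hPz.ne' ?_
    linear_combination hgQ + hc
  obtain rfl | rfl : c = 0 ∨ c = 1 := by omega
  · have hEg : (E : ℤ) ∣ g := hk g ⟨u, by rw [hkg, add_zero]⟩
    have hEGz : (E : ℤ) ∣ G := by exact_mod_cast hEG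
    have hw : i * P = ρ * v + g := by rw [hg]; ring
    have hEi : (E : ℤ) ∣ i := by
      have h2 : i = ρ * v + g - G * (i * β) := by
        rw [← hw, hPe]; ring
      rw [h2]
      exact dvd_sub (dvd_add ((hEGz.mul_left _).mul_right _) hEg) (hEGz.mul_right _)
    have hi0 : 0 < i := by
      have : 0 < i * P := by rw [hw]; positivity
      exact pos_of_mul_pos_left this hPz.le
    have hiG : i < G := by
      refine lt_of_mul_lt_mul_right ?_ hPz.le
      rw [hw]
      have := mul_le_mul_of_nonneg_left hvV hρ.le
      linarith
    have hgi : ρ ∣ g - i := by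
      obtain ⟨j, rfl⟩ := hEi
      have h4 : g - E * j = E * G * (j * β) - ρ * v := by
        have : g = E * j * P - ρ * v := hg
        rw [this, hPe]; ring
      rw [h4]
      exact dvd_sub (hrEGz.mul_right _) (dvd_mul_right _ _)
    have := Int.eq_zero_of_abs_lt_dvd hgi (by rw [abs_lt]; constructor <;> linarith)
    linarith
  · have hrk' : (r : ℤ) ∣ k := by exact_mod_cast hrk
    have : (r : ℤ) ∣ 1 := by
      have h5 : (1 : ℤ) = k * g - r * (G * u) := by rw [hkg, hρd]; ring
      rw [h5]
      exact dvd_sub (hrk'.mul_right _) (dvd_mul_right _ _)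
    have := Int.le_of_dvd one_pos this
    linarith

theorem card_le_negCount {P k V G ρ E : ℕ} (hk0 : 0 < k) (hρ : 0 < ρ)
    (hk : ∀ g : ℕ, E ∣ g → ρ ∣ k * g) (hEρ : E ∣ ρ) (hle : ρ ≤ P) (δ : ℤ) (W : Finset ℕ)
    (hW : ∀ w ∈ W, E ∣ w ∧ G ≤ w % ρ ∧ w < ρ * V ∧ (P : ℤ) ∣ w - δ) :
    (W.card : ℤ) ≤ negCount P k V ρ (ρ - G + δ * (1 + k * P : ℕ)) := by
  simp only [negCount, residueIndicator]
  rw [Finset.sum_boole]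
  rw [Nat.cast_le]
  have hdiv : ∀ w ∈ W, ρ * (k * (w % ρ) / ρ) = k * (w % ρ) := fun w hw =>
    Nat.mul_div_cancel' (hk _ ((Nat.dvd_mod_iff hEρ).2 (hW w hw).1))
  refine Finset.card_le_card_of_injOn (fun w => (k * (w % ρ) / ρ, w / ρ)) ?_ ?_
  · intro w hw
    obtain ⟨hEw, hGw, hwV, c, hc⟩ := hW w hw
    have hu := hdiv w hw
    have hg := Nat.mod_lt w hρ
    have hwe := Nat.mod_add_div w ρ
    simp only [Finset.coe_filter, Finset.mem_product, Finset.mem_range, Set.mem_ofPred_eq]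
    refine ⟨⟨?_, Nat.div_lt_of_lt_mul hwV⟩, ?_⟩
    · refine Nat.lt_of_mul_lt_mul_left (a := ρ) ?_
      rw [hu, mul_comm ρ k]
      exact Nat.mul_lt_mul_of_pos_left hg hk0
    · generalize w % ρ = g at *
      generalize w / ρ = v at *
      generalize k * g / ρ = u at *
      have e : (ρ - G + δ * (1 + k * P : ℕ) - ρ * (1 + u * P + v * (1 + k * P) : ℕ) : ℤ) =
          ((g - G : ℕ) : ℤ) + P * (1 + k * P : ℕ) * (-c) := by
        zify at hu hwe
        push_cast [hGw]
        linear_combination (-P : ℤ) * hu - (1 + k * P : ℤ) * hwe - (1 + k * P) * hc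
      have hPM : P ≤ P * (1 + k * P) := Nat.le_mul_of_pos_right _ (by omega)
      rw [e, Int.add_mul_emod_self_left, Int.emod_eq_of_lt (by positivity)]
      · omega
      · norm_cast
        omega
  · intro w hw w' hw' h
    simp only [Prod.mk.injEq] at h
    have h1 : k * (w % ρ) = k * (w' % ρ) := by rw [← hdiv w hw, ← hdiv w' hw', h.1]
    have h2 := Nat.eq_of_mul_eq_mul_left hk0 h1
    rw [← Nat.mod_add_div w ρ, ← Nat.mod_add_div w' ρ, h2, h.2]

theorem mod_eq_of_eq_add_mul {w ρ : ℕ} {g z : ℤ} (hg : 0 ≤ g) (hgρ : g < ρ)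
    (h : (w : ℤ) = g + ρ * z) :
    ((w % ρ : ℕ) : ℤ) = g := by
  rw [Int.natCast_emod, h, Int.add_mul_emod_self_left, Int.emod_eq_of_lt hg hgρ]

theorem le_negCount_sub {P k V G E L r β : ℕ} (hr : 1 < r) (hG : G = E * L) (hE : 2 ≤ E)
    (hP : P = 1 + G * β) (hβ : ¬ r ∣ β) (hrEG : r * G ∣ E * G) (hk0 : 0 < k)
    (hk : ∀ g : ℕ, E ∣ g → r * G ∣ k * g) (hle : r * G ≤ P) (hV : G * P ≤ r * G * V + P) :
    (L : ℤ) ≤ negCount P k V (r * G : ℕ) ((r * G : ℕ) - G - (1 + k * P : ℕ)) := by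
  have hinj : Function.Injective fun l => G * β + E * l * P := by
    intro a b hab
    have h1 : E * a * P = E * b * P := by simpa using hab
    have h2 := Nat.eq_of_mul_eq_mul_right (by omega) h1
    exact Nat.eq_of_mul_eq_mul_left (by omega) h2
  have hcard : ((Finset.range L).image fun l => G * β + E * l * P).card = L := by
    rw [Finset.card_image_of_injective _ hinj, Finset.card_range]
  rw [sub_eq_add_neg _ ((1 + k * P : ℕ) : ℤ), neg_eq_neg_one_mul ((1 + k * P : ℕ) : ℤ)]
  rcases L.eq_zero_or_pos with rfl | hL
  · rw [Nat.cast_zero]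
    exact sum_residueIndicator_nonneg _ _ _ _
  have hG0 : 0 < G := by rw [hG]; positivity
  have hEρ : E ∣ r * G := by rw [hG]; exact (dvd_mul_right E L).mul_left r
  conv_lhs => rw [← hcard]
  refine card_le_negCount hk0 (by positivity) hk hEρ hle (-1) _ fun w hw => ?_
  simp only [Finset.mem_image, Finset.mem_range] at hw
  obtain ⟨l, hl, rfl⟩ := hw
  have hEl : E * (l + 1) ≤ G := by rw [hG]; exact Nat.mul_le_mul_left _ hl
  refine ⟨?_, ?_, ?_, ?_⟩
  · rw [hG]
    exact dvd_add ⟨L * β, by ring⟩ ⟨l * P, by ring⟩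
  · obtain ⟨c, hc⟩ := hrEG
    have hb := Nat.mod_lt β (by omega : r > 0)
    have hb0 : 0 < β % r := Nat.pos_of_ne_zero fun h => hβ (Nat.dvd_of_mod_eq_zero h)
    have hβe := Nat.mod_add_div β r
    have hlt : G * (β % r + 1) ≤ G * r := Nat.mul_le_mul_left _ hb
    have hge : G * 1 ≤ G * (β % r) := Nat.mul_le_mul_left _ hb0
    have := mod_eq_of_eq_add_mul (w := G * β + E * l * P) (ρ := r * G)
      (g := G * (β % r : ℕ) + E * l) (z := (β / r : ℕ) + c * l * β) (by positivity)
      (by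
        norm_cast
        rw [mul_add] at hEl hlt
        rw [mul_comm r G]
        omega)
      (by
        norm_cast
        conv_lhs => rw [hP, ← hβe]
        linear_combination (l * (β % r + r * (β / r))) * hc + r * G * c * l * hβe)
    norm_cast at this
    rw [this]
    omega
  · have h1 : (E * (l + 1)) * P ≤ G * P := Nat.mul_le_mul_right _ hEl
    have h2 : 2 * P ≤ E * P := Nat.mul_le_mul_right _ hE
    have h3 : E * (l + 1) * P = E * l * P + E * P := by ring
    omega
  · refine ⟨1 + E * l, ?_⟩
    have : (P : ℤ) = 1 + G * β := by exact_mod_cast hP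
    push_cast
    linear_combination -this

theorem le_negCount_add {P k V G E L r β : ℕ} (hr : 1 < r) (hG : G = E * L) (hE : 2 ≤ E)
    (hP : P = 1 + G * β) (hβ : ¬ r ∣ β) (hrEG : r * G ∣ E * G) (hk0 : 0 < k)
    (hk : ∀ g : ℕ, E ∣ g → r * G ∣ k * g) (hle : r * G ≤ P) (hV : G * P ≤ r * G * V + P) :
    (L : ℤ) - 1 ≤ negCount P k V (r * G : ℕ) ((r * G : ℕ) - G + (1 + k * P : ℕ)) := by
  obtain rfl | ⟨L, rfl⟩ : L = 0 ∨ ∃ l, L = l + 1 := by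
    rcases L with _ | l
    · exact .inl rfl
    · exact .inr ⟨l, rfl⟩
  · rw [Nat.cast_zero]
    have := sum_residueIndicator_nonneg (Finset.range k ×ˢ Finset.range V)
      (P * (1 + k * P : ℕ)) P fun x => ((r * G : ℕ) - G + (1 + k * P : ℕ) : ℤ) -
        (r * G : ℕ) * (1 + x.1 * P + x.2 * (1 + k * P) : ℕ)
    rw [negCount]
    linarith
  have hPE : P ≤ E * P := Nat.le_mul_of_pos_left _ (by omega)
  have hval : ∀ l, ((E * (l + 1) * P - G * β : ℕ) : ℤ) = E * (l + 1) * P - G * β := by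
    intro l
    rw [Nat.cast_sub]
    · push_cast; rfl
    · have : E * (l + 1) * P = E * l * P + E * P := by ring
      omega
  have hinj : Function.Injective fun l => E * (l + 1) * P - G * β := by
    intro a b hab
    have h1 := congrArg (Nat.cast (R := ℤ)) hab
    simp only [hval] at h1
    have h2 : E * (a + 1) * P = E * (b + 1) * P := by zify; linarith
    have h3 := Nat.eq_of_mul_eq_mul_right (by omega) h2
    exact Nat.succ_injective (Nat.eq_of_mul_eq_mul_left (by omega) h3)
  have hcard : ((Finset.range L).image fun l => E * (l + 1) * P - G * β).card = L := by
    rw [Finset.card_image_of_injective _ hinj, Finset.card_range]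
  rw [← one_mul ((1 + k * P : ℕ) : ℤ)]
  have hG0 : 0 < G := by rw [hG]; positivity
  have hEρ : E ∣ r * G := by rw [hG]; exact (dvd_mul_right E _).mul_left r
  rw [Nat.cast_succ, add_sub_cancel_right]
  conv_lhs => rw [← hcard]
  refine card_le_negCount hk0 (by positivity) hk hEρ hle 1 _ fun w hw => ?_
  simp only [Finset.mem_image, Finset.mem_range] at hw
  obtain ⟨l, hl, rfl⟩ := hw
  have hEl : E * (l + 1) + E ≤ G := by
    rw [hG, ← Nat.mul_succ]; exact Nat.mul_le_mul_left _ (by omega)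
  refine ⟨?_, ?_, ?_, ?_⟩
  · refine Nat.dvd_sub ⟨(l + 1) * P, by ring⟩ ?_
    rw [hG]
    exact ⟨(L + 1) * β, by ring⟩
  · obtain ⟨c, hc⟩ := hrEG
    have hb := Nat.mod_lt β (by omega : r > 0)
    have hb0 : 0 < β % r := Nat.pos_of_ne_zero fun h => hβ (Nat.dvd_of_mod_eq_zero h)
    have hβe := Nat.mod_add_div β r
    have hlt : G * (β % r + 1) ≤ G * r := Nat.mul_le_mul_left _ hb
    have hge : G * 1 ≤ G * (β % r) := Nat.mul_le_mul_left _ hb0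
    have hPz : (P : ℤ) = 1 + G * β := by exact_mod_cast hP
    rw [mul_add] at hlt
    zify at hc hβe hlt hge hEl
    have := mod_eq_of_eq_add_mul (w := E * (l + 1) * P - G * β) (ρ := r * G)
      (g := r * G - G * (β % r : ℕ) + E * (l + 1)) (z := -(β / r : ℕ) - 1 + c * (l + 1) * β)
      (by push_cast; nlinarith) (by push_cast; nlinarith)
      (by
        rw [hval]
        push_cast
        linear_combination (E * (l + 1) : ℤ) * hPz + G * hβe + (l + 1) * β * hc)
    zify
    push_cast at this ⊢
    rw [this]
    nlinarith
  · have h1 : (E * (l + 1) + E) * P ≤ G * P := Nat.mul_le_mul_right _ hEl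
    have h2 : 2 * P ≤ E * P := Nat.mul_le_mul_right _ hE
    have h3 : (E * (l + 1) + E) * P = E * (l + 1) * P + E * P := by ring
    omega
  · refine ⟨E * (l + 1) - 1, ?_⟩
    have : (P : ℤ) = 1 + G * β := by exact_mod_cast hP
    rw [hval]
    linear_combination this

theorem exists_succ_eq_of_abs_sub_le_one {f : ℕ → ℤ} (h0 : f 0 = 0)
    (hf : ∀ i, |f (i + 1) - f i| ≤ 1) {n : ℤ} (hn : 0 < n) :
    ∀ {M : ℕ}, n ≤ f M → ∃ i, f (i + 1) = n
  | 0, h => by omega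
  | M + 1, h => by
    by_cases hM : n ≤ f M
    · exact exists_succ_eq_of_abs_sub_le_one h0 hf hn hM
    · have := abs_le.1 (hf M)
      exact ⟨M, by omega⟩

theorem mem_coeffSet_of_partial_sum {P k R : ℕ} (hP : 2 ≤ P) (hk : 0 < k)
    (hR : P * (1 + k * P) ≤ R) (hPR : P.Coprime R) (hQR : (1 + k * P).Coprime R) {ρ : ℤ}
    (hρ : (R : ℤ) ≡ ρ [ZMOD P * (1 + k * P : ℕ)]) (s : ℤ) {n : ℤ} (hn : n ≠ 0) {N : ℕ}
    (hN : ∑ j ∈ Finset.range (N + 1),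
      (binaryPoly P k).coeff j * inverseCoeff P (1 + k * P : ℕ) (s - ρ * j) = n) :
    n ∈ coeffSet P (1 + k * P) R := by
  have hP0 : 0 < P := by omega
  have hkP : P ≤ k * P := Nat.le_mul_of_pos_left _ hk
  have hM : (0 : ℤ) < P * (1 + k * P : ℕ) := by positivity
  have hR0 : 0 < R := lt_of_lt_of_le (by positivity) hR
  set t := ((s - ρ * N) % (P * (1 + k * P : ℕ))).toNat with ht
  have htz : (t : ℤ) = (s - ρ * N) % (P * (1 + k * P : ℕ)) :=
    Int.toNat_of_nonneg (Int.emod_nonneg _ hM.ne')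
  have htR : t < R := by
    have := Int.emod_lt_of_pos (s - ρ * N) hM
    zify at hR ⊢
    push_cast at *
    linarith
  have hb := binaryPoly_mul (P := P) (k := k) hP0
  have hcoeff := Qpoly_coeff (binaryPoly_monic (k := k) hP0) hP (by omega) hR0 hPR hQR hb
    (N := N) htR
  have hc : (Qpoly P (1 + k * P) R).coeff (R * N + t) = n := by
    rw [hcoeff, ← hN]
    refine Finset.sum_congr rfl fun j _ => ?_
    congr 1
    refine inverseCoeff_congr ?_
    have h1 : (t : ℤ) ≡ s - ρ * N [ZMOD P * (1 + k * P : ℕ)] := by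
      rw [htz]; exact Int.mod_modEq _ _
    have h2 := (hρ.mul_right ((N : ℤ) - j)).add h1
    convert h2 using 1
    ring
  refine ⟨R * N + t, ?_, hc⟩
  rw [← natDegree_Qpoly (binaryPoly_monic (k := k) hP0) hP0 (by omega) hR0 hPR hQR hb]
  exact le_natDegree_of_ne_zero (hc ▸ hn)

theorem zero_mem_coeffSet {P k R : ℕ} (hP : 2 ≤ P) (hk : 0 < k)
    (hR : P * (1 + k * P) ≤ R) (hPR : P.Coprime R) (hQR : (1 + k * P).Coprime R) :
    0 ∈ coeffSet P (1 + k * P) R := by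
  have hP0 : 0 < P := by omega
  have hkP : P ≤ k * P := Nat.le_mul_of_pos_left _ hk
  have hPR' : P < R := by nlinarith
  have hcoeff := Qpoly_coeff (binaryPoly_monic (k := k) hP0) hP (by omega) (by omega) hPR hQR
    (binaryPoly_mul hP0) (N := 0) hPR'
  refine ⟨P, ?_, ?_⟩
  · calc P ≤ 1 * (k * P) * 1 := by omega
      _ ≤ _ := Nat.mul_le_mul (Nat.mul_le_mul (by omega) (by omega)) (by omega)
  · rw [mul_zero, zero_add] at hcoeff
    rw [hcoeff, zero_add, Finset.sum_range_one, inverseCoeff, residueIndicator, residueIndicator,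
      if_neg, if_neg, sub_zero, mul_zero]
    · rw [← Int.add_emod_right, Int.emod_eq_of_lt] <;> push_cast <;> nlinarith
    · rw [Int.emod_eq_of_lt] <;> push_cast <;> nlinarith

theorem mem_coeffSet {P k V G E L R r β : ℕ} (hr : 1 < r) (hG : G = E * L) (hL : 0 < L)
    (hE : 2 ≤ E) (hP : P = 1 + G * β) (hβ : ¬ r ∣ β) (hrEG : r * G ∣ E * G) (hk0 : 0 < k)
    (hk : ∀ g : ℤ, (r * G : ℤ) ∣ k * g ↔ (E : ℤ) ∣ g) (hrk : r ∣ k) (hle : r * G ≤ P)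
    (hV : V = P / r) (hR : P * (1 + k * P) ≤ R) (hPR : P.Coprime R)
    (hQR : (1 + k * P).Coprime R) (hQρ : (1 + k * P).Coprime (r * G))
    (hρ : R ≡ r * G [MOD P * (1 + k * P)]) {n : ℤ} (hn : |n| + 2 ≤ L) :
    n ∈ coeffSet P (1 + k * P) R := by
  have hG0 : 0 < G := by rw [hG]; positivity
  have hrG : 2 * 1 ≤ r * G := Nat.mul_le_mul hr hG0
  have hP2 : 2 ≤ P := by omega
  have hP0 : 0 < P := by omega
  have hkn : ∀ g : ℕ, E ∣ g → r * G ∣ k * g := fun g hg => by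
    have := (hk g).2 (by exact_mod_cast hg)
    exact_mod_cast this
  have hVP : V ≤ P - 1 := by
    have := Nat.div_lt_self hP0 hr
    omega
  have hV1 : r * G * V ≤ G * P := by
    have := Nat.mul_le_mul_left G (Nat.mul_div_le P r)
    rw [hV]
    calc r * G * (P / r) = G * (r * (P / r)) := by ring
      _ ≤ _ := this
  have hV2 : G * P ≤ r * G * V + P := by
    have h1 : P ≤ r * V + r := by
      have := Nat.lt_mul_div_succ P (by omega : 0 < r)
      rw [← hV, mul_add, mul_one] at this
      exact this.le
    calc G * P ≤ G * (r * V + r) := Nat.mul_le_mul_left _ h1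
      _ = r * G * V + r * G := by ring
      _ ≤ _ := by omega
  have hz := negCount_eq_zero hr hG0 hP (hG ▸ dvd_mul_right E L) hrEG (fun g => (hk g).1) hrk hle
    hV1
  have hs := le_negCount_sub hr hG hE hP hβ hrEG hk0 hkn hle hV2
  have ha := le_negCount_add hr hG hE hP hβ hrEG hk0 hkn hle hV2
  have hρc : IsCoprime ((1 + k * P : ℕ) : ℤ) (r * G : ℕ) := Nat.isCoprime_iff_coprime.2 hQρ
  have hρz : (R : ℤ) ≡ (r * G : ℕ) [ZMOD P * (1 + k * P : ℕ)] := by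
    have := Int.natCast_modEq_iff.2 hρ
    rwa [Nat.cast_mul P] at this
  have hbs := abs_sum_add_negCount_le hP0 hk0 hVP hρc
  have hstep : ∀ s : ℤ, ∀ i : ℕ, |∑ j ∈ Finset.range (i + 1), (binaryPoly P k).coeff j *
      inverseCoeff P (1 + k * P : ℕ) (s - (r * G : ℕ) * j) - ∑ j ∈ Finset.range i,
      (binaryPoly P k).coeff j * inverseCoeff P (1 + k * P : ℕ) (s - (r * G : ℕ) * j)| ≤ 1 := by
    intro s i
    rw [Finset.sum_range_succ, add_sub_cancel_left, abs_mul]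
    exact mul_le_one₀ (abs_binaryPoly_coeff_le hP0 i) (abs_nonneg _) (abs_inverseCoeff_le _ _ _)
  rcases lt_trichotomy n 0 with h | rfl | h
  · have hb := (abs_le.1 (hbs ((r * G : ℕ) - G + (1 + k * P : ℕ)))).2
    rw [add_sub_cancel_right, hz] at hb
    rw [abs_of_neg h] at hn
    obtain ⟨N, hN⟩ := exists_succ_eq_of_abs_sub_le_one (n := -n) (M := V * (1 + k * P))
      (f := fun i => -∑ j ∈ Finset.range i, (binaryPoly P k).coeff j *
        inverseCoeff P (1 + k * P : ℕ)
          ((r * G : ℕ) - G + (1 + k * P : ℕ) - (r * G : ℕ) * j)) (by simp)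
      (fun i => by
        rw [neg_sub_neg, abs_sub_comm]
        exact hstep _ i) (by omega) (by linarith)
    exact mem_coeffSet_of_partial_sum hP2 hk0 hR hPR hQR hρz _ h.ne (neg_injective hN)
  · exact zero_mem_coeffSet hP2 hk0 hR hPR hQR
  · have hb := (abs_le.1 (hbs ((r * G : ℕ) - G))).1
    rw [hz] at hb
    rw [abs_of_pos h] at hn
    obtain ⟨N, hN⟩ := exists_succ_eq_of_abs_sub_le_one (n := n) (M := V * (1 + k * P))
      (f := fun i => ∑ j ∈ Finset.range i, (binaryPoly P k).coeff j *
        inverseCoeff P (1 + k * P : ℕ) ((r * G : ℕ) - G - (r * G : ℕ) * j)) (by simp)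
      (hstep _) h (by linarith)
    exact mem_coeffSet_of_partial_sum hP2 hk0 hR hPR hQR hρz _ h.ne' hN

theorem pow_eq_one_add_mul_of_coprime {b r m t β : ℕ} (hr : r.Prime) (hb : b = 1 + r ^ m * β)
    (hm : 0 < m) (hβ : ¬ r ∣ β) (ht : t.Coprime r) :
    ∃ γ, b ^ t = 1 + r ^ m * γ ∧ ¬ r ∣ γ := by
  refine ⟨β * ∑ i ∈ Finset.range t, b ^ i, ?_, ?_⟩
  · zify
    have h1 := mul_geom_sum (b : ℤ) t
    have h2 : (b : ℤ) - 1 = r ^ m * β := by rw [hb]; push_cast; ring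
    rw [h2] at h1
    linear_combination -h1
  · rw [hr.dvd_mul, not_or]
    refine ⟨hβ, fun h => ?_⟩
    have hb' : b ≡ 1 [MOD r] := by
      rw [hb]
      exact (Nat.modEq_zero_iff_dvd.2 ((dvd_pow_self r hm.ne').mul_right β)).add_left 1
    have hs : ∑ i ∈ Finset.range t, b ^ i ≡ ∑ i ∈ Finset.range t, 1 [MOD r] :=
      Nat.ModEq.sum fun i _ => by simpa using hb'.pow i
    rw [Finset.sum_const, Finset.card_range, smul_eq_mul, mul_one] at hs
    have : r ∣ t := (hs.dvd_iff dvd_rfl).1 h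
    exact hr.one_lt.ne' (Nat.eq_one_of_dvd_coprimes ht this dvd_rfl)

theorem exists_pow_totient_eq {b r m e : ℕ} (hr : r.Prime) (hb : 1 < b) (hbr : b.Coprime r)
    (he : (r ^ m).totient ∣ e) (he0 : 0 < e) :
    ∃ x β, m ≤ x ∧ b ^ e = 1 + r ^ x * β ∧ ¬ r ∣ β := by
  have h1 : 1 < b ^ e := Nat.one_lt_pow he0.ne' hb
  obtain ⟨x, β, hβ, h⟩ := Nat.exists_eq_pow_mul_and_not_dvd (n := b ^ e - 1) (by omega) r hr.ne_one
  refine ⟨x, β, ?_, by omega, hβ⟩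
  obtain ⟨c, rfl⟩ := he
  have h2 : 1 ≡ b ^ ((r ^ m).totient * c) [MOD r ^ m] := by
    have := (Nat.ModEq.pow_totient (hbr.pow_right m)).pow c
    rw [one_pow, ← pow_mul] at this
    exact this.symm
  have h3 := (Nat.modEq_iff_dvd' h1.le).1 h2
  rw [h] at h3
  by_contra hx
  have h4 : r ^ (x + 1) ∣ r ^ x * β := (pow_dvd_pow r (by omega)).trans h3
  rw [pow_succ] at h4
  exact hβ (Nat.dvd_of_mul_dvd_mul_left (pow_pos hr.pos x) h4)

theorem exists_mem_coeffSet_prime_pow {p q r : ℕ} (hp : p.Prime) (hq : q.Prime) (hr : r.Prime)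
    (hpq : p ≠ q) (hpr : p ≠ r) (hqr : q ≠ r) (n : ℤ) :
    ∃ a b c : ℕ, (0 < a ∧ 0 < b ∧ 0 < c ∧ 2 < p ^ a ∧ 2 < q ^ b ∧ 2 < r ^ c) ∧
      n ∈ coeffSet (p ^ a) (q ^ b) (r ^ c) := by
  have cpr : p.Coprime r := (Nat.coprime_primes hp hr).2 hpr
  have cqr : q.Coprime r := (Nat.coprime_primes hq hr).2 hqr
  have cqp : q.Coprime p := (Nat.coprime_primes hq hp).2 hpq.symm
  have hp1 := hp.two_le
  have hr2 := hr.two_le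
  have tot_pos : ∀ m, 0 < (r ^ m).totient := fun m => Nat.totient_pos.2 (pow_pos hr.pos m)
  obtain ⟨x, β₁, hx, hq₁, hβ₁⟩ := exists_pow_totient_eq (m := n.natAbs + 3)
    (e := (r ^ (n.natAbs + 3)).totient * (p - 1)) hr hq.one_lt cqr (dvd_mul_right _ _)
    (Nat.mul_pos (tot_pos _) (by omega))
  obtain ⟨y, β₂, hxy, hp₁, hβ₂⟩ := exists_pow_totient_eq (m := x) hr hp.one_lt cpr dvd_rfl
    (tot_pos x)
  obtain ⟨β, hP, hβ⟩ := pow_eq_one_add_mul_of_coprime (t := r + 1) hr hp₁ (by omega) hβ₂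
    (by simp)
  rw [← pow_mul] at hP
  set a := (r ^ x).totient * (r + 1) with ha
  have ha0 : 0 < a := Nat.mul_pos (tot_pos x) (by omega)
  obtain ⟨β₃, hQ, hβ₃⟩ := pow_eq_one_add_mul_of_coprime (t := p ^ (a - 1)) hr hq₁ (by omega) hβ₁
    (cpr.pow_left _)
  rw [← pow_mul] at hQ
  set b := (r ^ (n.natAbs + 3)).totient * (p - 1) * p ^ (a - 1) with hb
  have hb0 : 0 < b :=
    Nat.mul_pos (Nat.mul_pos (tot_pos _) (by omega)) (pow_pos hp.pos _)
  have hQ1 : 1 < q ^ b := Nat.one_lt_pow hb0.ne' hq.one_lt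
  have hPQ : p ^ a ∣ q ^ b - 1 := by
    refine (Nat.modEq_iff_dvd' hQ1.le).1 ?_
    have := (Nat.ModEq.pow_totient (cqp.pow_right a)).pow (r ^ (n.natAbs + 3)).totient
    rw [one_pow, ← pow_mul, Nat.totient_prime_pow hp ha0] at this
    rw [hb]
    convert this.symm using 2
    ring
  obtain ⟨k, hk⟩ := hPQ
  have hkQ : q ^ b = 1 + k * p ^ a := by rw [mul_comm]; omega
  have hk0 : 0 < k := Nat.pos_of_ne_zero fun h => by rw [h] at hkQ; omega
  have hkP : k * p ^ a = r ^ x * β₃ := by omega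
  obtain ⟨k₀, rfl⟩ : r ^ x ∣ k :=
    (Nat.Coprime.pow x a cpr.symm).dvd_of_dvd_mul_right ⟨_, hkP⟩
  have hk₀ : ¬ r ∣ k₀ := by
    intro h
    have h1 : k₀ * p ^ a = β₃ := by
      refine Nat.eq_of_mul_eq_mul_left (pow_pos hr.pos x) ?_
      rw [← hkP, mul_assoc]
    exact hβ₃ (h1 ▸ h.mul_right _)
  have hrx : r ≤ r ^ x := Nat.le_self_pow (by omega) r
  have hβ0 : 0 < β₂ := Nat.pos_of_ne_zero fun h => hβ₂ (h ▸ dvd_zero r)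
  have hle : r * r ^ y ≤ p ^ a := by
    have h1 : r ^ y ≤ p ^ (r ^ x).totient := by
      rw [hp₁]
      have := Nat.le_mul_of_pos_right (r ^ y) hβ0
      omega
    have h2 : r ≤ p ^ (r ^ x).totient :=
      (hrx.trans (Nat.pow_le_pow_right hr.pos hxy)).trans h1
    calc r * r ^ y ≤ p ^ (r ^ x).totient * p ^ (r ^ x).totient := Nat.mul_le_mul h2 h1
      _ = (p ^ (r ^ x).totient) ^ 2 := by ring
      _ ≤ (p ^ (r ^ x).totient) ^ (r + 1) :=
        Nat.pow_le_pow_right (pow_pos hp.pos _) (by omega)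
      _ = p ^ a := by rw [ha, pow_mul]
  have hry : 2 ≤ r ^ y := hr2.trans (Nat.le_self_pow (by omega) r)
  have hP2 : 4 ≤ p ^ a := (Nat.mul_le_mul hr2 hry).trans hle
  have cPr : (p ^ a).Coprime r := cpr.pow_left a
  have cQr : (1 + r ^ x * k₀ * p ^ a).Coprime r := hkQ ▸ cqr.pow_left b
  set M := p ^ a * (1 + r ^ x * k₀ * p ^ a) with hM
  have hM0 : 0 < M := by positivity
  refine ⟨a, b, (y + 1) + M.totient * M, ⟨ha0, hb0, by omega, by omega, ?_, ?_⟩, ?_⟩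
  · have := Nat.le_mul_of_pos_left (p ^ a) hk0
    omega
  · calc 2 < 2 * 2 := by norm_num
      _ ≤ r * r ^ y := Nat.mul_le_mul hr2 hry
      _ = r ^ (y + 1) := by ring
      _ ≤ _ := Nat.pow_le_pow_right hr.pos (by omega)
  rw [hkQ]
  have hpow : r * r ^ y = r ^ (y + 1) := by ring
  have hEG : r ^ (y + 1 - x) * r ^ x = r ^ (y + 1) := by
    rw [← pow_add]; congr 1; omega
  refine mem_coeffSet (V := p ^ a / r) (G := r ^ y) (E := r ^ (y + 1 - x)) (L := r ^ (x - 1))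
    hr.one_lt ?_ (pow_pos hr.pos _) (hr2.trans (Nat.le_self_pow (by omega) r)) hP hβ ?_ hk0 ?_
    ((dvd_pow_self r (by omega)).mul_right _) hle rfl ?_ (cPr.pow_right _) (cQr.pow_right _)
    ?_ ?_ ?_
  · rw [← pow_add]; congr 1; omega
  · rw [hpow, ← pow_add]
    exact pow_dvd_pow r (by omega)
  · intro g
    have hx0 : (r ^ x : ℤ) ≠ 0 := by exact_mod_cast (pow_pos hr.pos x).ne'
    have e1 : (r * (r ^ y : ℕ) : ℤ) = r ^ x * (r ^ (y + 1 - x) : ℕ) := by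
      norm_cast
      rw [hpow, ← hEG, mul_comm]
    have e2 : ((r ^ x * k₀ : ℕ) : ℤ) * g = r ^ x * (k₀ * g) := by push_cast; ring
    rw [e1, e2, mul_dvd_mul_iff_left hx0]
    refine ⟨fun h => IsCoprime.dvd_of_dvd_mul_left ?_ h, fun h => h.mul_left _⟩
    exact Nat.isCoprime_iff_coprime.2 (((hr.coprime_iff_not_dvd).2 hk₀).pow_left _)
  · calc M ≤ 2 ^ M := Nat.lt_two_pow_self.le
      _ ≤ r ^ M := Nat.pow_le_pow_left hr2 M
      _ ≤ _ := Nat.pow_le_pow_right hr.pos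
        ((Nat.le_mul_of_pos_left M (Nat.totient_pos.2 hM0)).trans (Nat.le_add_left _ _))
  · rw [hpow]
    exact cQr.pow_right _
  · have := (Nat.ModEq.pow_totient ((cPr.mul_left cQr).symm)).pow M
    rw [one_pow, ← pow_mul] at this
    rw [hpow, pow_add]
    simpa using this.mul_left (r ^ (y + 1))
  · have h1 : n.natAbs + 2 < r ^ (n.natAbs + 2) := Nat.lt_pow_self hr.one_lt
    have h2 : r ^ (n.natAbs + 2) ≤ r ^ (x - 1) := Nat.pow_le_pow_right hr.pos (by omega)
    rw [Int.abs_eq_natAbs]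
    exact_mod_cast h1.le.trans h2

theorem stmt_1 (p q r : ℕ) (hp : p.Prime) (hq : q.Prime) (hr : r.Prime)
    (hpq : p ≠ q) (hpr : p ≠ r) (hqr : q ≠ r) :
    (⋃ (a : ℕ) (b : ℕ) (c : ℕ)
        (_ : 0 < a ∧ 0 < b ∧ 0 < c ∧ 2 < p ^ a ∧ 2 < q ^ b ∧ 2 < r ^ c),
        coeffSet (p ^ a) (q ^ b) (r ^ c)) = Set.univ := by
  refine Set.eq_univ_of_forall fun n => ?_
  obtain ⟨a, b, c, h, hn⟩ := exists_mem_coeffSet_prime_pow hp hq hr hpq hpr hqr n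
  simp only [Set.mem_iUnion]
  exact ⟨a, b, c, h, hn⟩
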